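/- arXiv:1603.00166 — 2 statements merged into one kernel-verified Lean document; each statement's English description precedes it below -/
import Mathlib

section
/- Let n ≥ 1 and let f : ℝⁿ → ℝ be smooth and convex (⟨Hess f(x) v, v⟩ ≥ 0 for all x, v ∈ ℝⁿ, i.e. Ric_f ≥ 0 in the Euclidean setting). Let u : ℝⁿ × (−∞, 0] → ℝ be a smooth positive ancient solution to the f-heat equation ∂u/∂t = Δ_f u satisfying the growth condition u(x,t) = o( ( |x−x₀|^{1/2} + |t|^{1/4} )² ) near infinity, i.e. u(x,t)/( |x−x₀|^{1/2} + |t|^{1/4} )² → 0 as |x−x₀| + |t| → ∞ for some fixed x₀ ∈ ℝⁿ. Then u is constant. (This is the Euclidean-space case of the paper's Theorem 1.2(iii).) -/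
open Metric Set
open scoped RealInnerProductSpace

noncomputable section

/-- Euclidean Laplacian on `EuclideanSpace ℝ (Fin n)`. -/
def eLap {n : ℕ} (u : EuclideanSpace ℝ (Fin n) → ℝ) (x : EuclideanSpace ℝ (Fin n)) : ℝ :=
  ∑ i : Fin n,
    fderiv ℝ (fun y => fderiv ℝ u y (EuclideanSpace.single i 1)) x (EuclideanSpace.single i 1)

/-- Weighted (drift) Laplacian `Δ_f u = Δu − ⟨∇f, ∇u⟩`. -/
def fLap {n : ℕ} (f u : EuclideanSpace ℝ (Fin n) → ℝ) (x : EuclideanSpace ℝ (Fin n)) : ℝ :=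
  eLap u x - ⟪gradient f x, gradient u x⟫

/-- Hessian quadratic form of `f` at `x` evaluated at `(v, v)`. -/
def hessQF {n : ℕ} (f : EuclideanSpace ℝ (Fin n) → ℝ) (x v : EuclideanSpace ℝ (Fin n)) : ℝ :=
  fderiv ℝ (fun y => fderiv ℝ f y v) x v

/-- The constant `α = max_{|x−x₀|=1} ((n−1) − ⟨∇f(x), x−x₀⟩)`. -/
def alphaC {n : ℕ} (f : EuclideanSpace ℝ (Fin n) → ℝ) (x₀ : EuclideanSpace ℝ (Fin n)) : ℝ :=
  sSup ((fun y => (n : ℝ) - 1 - ⟪gradient f y, y - x₀⟫) '' sphere x₀ 1)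


/-- Directional derivative in a fixed direction. -/
def dirD {X : Type*} [NormedAddCommGroup X] [NormedSpace ℝ X] (v : X) (g : X → ℝ) (p : X) : ℝ :=
  fderiv ℝ g p v

section DirD
variable {X : Type*} [NormedAddCommGroup X] [NormedSpace ℝ X] {S : Set X} {g k : X → ℝ}

lemma dirD_smooth (hS : IsOpen S) (hg : ContDiffOn ℝ (⊤ : ℕ∞) g S) (v : X) :
    ContDiffOn ℝ (⊤ : ℕ∞) (dirD v g) S := by
  have h1 : ContDiffOn ℝ (⊤ : ℕ∞) (fderiv ℝ g) S :=
    hg.fderiv_of_isOpen hS (by norm_cast)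
  exact h1.clm_apply contDiffOn_const

lemma smooth_diffAt (hS : IsOpen S) (hg : ContDiffOn ℝ (⊤ : ℕ∞) g S) {p : X} (hp : p ∈ S) :
    DifferentiableAt ℝ g p :=
  (hg.contDiffAt (hS.mem_nhds hp)).differentiableAt (by simp)

lemma dirD_comm (hS : IsOpen S) (hg : ContDiffOn ℝ (⊤ : ℕ∞) g S) (v w : X) {p : X} (hp : p ∈ S) :
    dirD v (dirD w g) p = dirD w (dirD v g) p := by
  have hc := hg.contDiffAt (hS.mem_nhds hp)
  have hsym := hc.isSymmSndFDerivAt (by simp; norm_cast)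
  have h1 : ContDiffOn ℝ (⊤ : ℕ∞) (fderiv ℝ g) S :=
    hg.fderiv_of_isOpen hS (by norm_cast)
  have h2 : DifferentiableAt ℝ (fderiv ℝ g) p :=
    (h1.contDiffAt (hS.mem_nhds hp)).differentiableAt (by simp)
  have key : ∀ a b : X, dirD a (dirD b g) p = fderiv ℝ (fderiv ℝ g) p a b := by
    intro a b
    have : HasFDerivAt (dirD b g) ((fderiv ℝ (fderiv ℝ g) p).flip b) p := by
      have := h2.hasFDerivAt.clm_apply (hasFDerivAt_const b p)
      exact this.congr_fderiv (by simp)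
    unfold dirD at this ⊢
    rw [this.fderiv]; simp
  rw [key, key]; exact hsym v w

lemma dirD_congr (hS : IsOpen S) (h : ∀ p ∈ S, g p = k p) (v : X) {p : X} (hp : p ∈ S) :
    dirD v g p = dirD v k p := by
  unfold dirD
  rw [Filter.EventuallyEq.fderiv_eq (f₁ := g) (f := k)]
  filter_upwards [hS.mem_nhds hp] with q hq using h q hq

lemma dirD_mul {p : X} (hg : DifferentiableAt ℝ g p) (hk : DifferentiableAt ℝ k p) (v : X) :
    dirD v (fun q => g q * k q) p = dirD v g p * k p + g p * dirD v k p := by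
  unfold dirD
  rw [fderiv_fun_mul hg hk]; simp; ring

lemma dirD_add {p : X} (hg : DifferentiableAt ℝ g p) (hk : DifferentiableAt ℝ k p) (v : X) :
    dirD v (fun q => g q + k q) p = dirD v g p + dirD v k p := by
  unfold dirD
  rw [fderiv_fun_add hg hk]; simp

lemma dirD_sub {p : X} (hg : DifferentiableAt ℝ g p) (hk : DifferentiableAt ℝ k p) (v : X) :
    dirD v (fun q => g q - k q) p = dirD v g p - dirD v k p := by
  unfold dirD
  rw [fderiv_fun_sub hg hk]; simp

lemma dirD_sum {ι : Type*} [Fintype ι] {p : X} {G : ι → X → ℝ}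
    (hg : ∀ i, DifferentiableAt ℝ (G i) p) (v : X) :
    dirD v (fun q => ∑ i, G i q) p = ∑ i, dirD v (G i) p := by
  unfold dirD
  rw [fderiv_fun_sum (fun i _ => hg i)]; simp

lemma dirD_const (c : ℝ) (v p : X) : dirD v (fun _ => c) p = 0 := by
  unfold dirD; simp

/-- derivative along a line -/
lemma dirD_line {p v : X} (s : ℝ) (hg : DifferentiableAt ℝ g (p + s • v)) :
    HasDerivAt (fun r : ℝ => g (p + r • v)) (dirD v g (p + s • v)) s := by
  have h1 : HasDerivAt (fun r : ℝ => p + r • v) v s := by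
    simpa using ((hasDerivAt_id s).smul_const v).const_add p
  exact hg.hasFDerivAt.comp_hasDerivAt s h1

lemma line_mem (hS : IsOpen S) {p : X} (hp : p ∈ S) (v : X) :
    ∀ᶠ r : ℝ in nhds 0, p + r • v ∈ S := by
  have : ContinuousAt (fun r : ℝ => p + r • v) 0 := by fun_prop
  exact this.preimage_mem_nhds (by simpa using hS.mem_nhds hp)

lemma dirD_max_first (hS : IsOpen S) (hg : ContDiffOn ℝ (⊤ : ℕ∞) g S) {p v : X} (hp : p ∈ S)
    (hmax : ∀ᶠ r : ℝ in nhds 0, g (p + r • v) ≤ g p) : dirD v g p = 0 := by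
  have h := dirD_line (g := g) (p := p) (v := v) 0 (by simpa using smooth_diffAt hS hg hp)
  have hm : IsLocalMax (fun r : ℝ => g (p + r • v)) 0 := by
    filter_upwards [hmax] with r hr; simpa using hr
  have := hm.hasDerivAt_eq_zero h
  simpa using this

lemma dirD_max_second (hS : IsOpen S) (hg : ContDiffOn ℝ (⊤ : ℕ∞) g S) {p v : X} (hp : p ∈ S)
    (hmax : ∀ᶠ r : ℝ in nhds 0, g (p + r • v) ≤ g p) : dirD v (dirD v g) p ≤ 0 := by
  by_contra hcon
  push Not at hcon
  have hd : ∀ᶠ r : ℝ in nhds 0, deriv (fun r : ℝ => g (p + r • v)) r = dirD v g (p + r • v) := by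
    filter_upwards [line_mem hS hp v] with r hr
    exact (dirD_line r (smooth_diffAt hS hg hr)).deriv
  have hdd : deriv (deriv (fun r : ℝ => g (p + r • v))) 0 = dirD v (dirD v g) p := by
    rw [Filter.EventuallyEq.deriv_eq hd]
    have := (dirD_line (g := dirD v g) (p := p) (v := v) 0
      (by simpa using smooth_diffAt hS (dirD_smooth hS hg v) hp)).deriv
    simpa using this
  have h0 := dirD_max_first hS hg hp hmax
  have hd0 : deriv (fun r : ℝ => g (p + r • v)) 0 = 0 := by
    rw [hd.self_of_nhds]; simpa using h0
  have hc : ContinuousAt (fun r : ℝ => g (p + r • v)) 0 := by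
    have := (dirD_line (g := g) (p := p) (v := v) 0 (by simpa using smooth_diffAt hS hg hp))
    exact this.continuousAt
  have hmin := isLocalMin_of_deriv_deriv_pos (by rw [hdd]; exact hcon) hd0 hc
  have hconst : (fun r : ℝ => g (p + r • v)) =ᶠ[nhds 0] fun _ => g p := by
    filter_upwards [hmax, hmin] with r h1 h2
    simp at h2
    exact le_antisymm h1 h2
  have h3 : deriv (fun r : ℝ => g (p + r • v)) =ᶠ[nhds 0] deriv (fun _ : ℝ => g p) := hconst.deriv
  have h4 := h3.deriv_eq
  rw [hdd] at h4
  simp at h4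
  linarith

lemma dirD_max_left (hS : IsOpen S) (hg : ContDiffOn ℝ (⊤ : ℕ∞) g S) {p v : X} (hp : p ∈ S)
    (hmax : ∀ᶠ r : ℝ in nhds 0, r ≤ 0 → g (p + r • v) ≤ g p) : 0 ≤ dirD v g p := by
  have h := dirD_line (g := g) (p := p) (v := v) 0 (by simpa using smooth_diffAt hS hg hp)
  simp only [zero_smul, add_zero] at h
  have h2 := h.hasDerivWithinAt (s := Iio 0)
  rw [hasDerivWithinAt_iff_tendsto_slope' (by simp)] at h2
  refine ge_of_tendsto h2 ?_
  have h3 := hmax.filter_mono (nhdsWithin_le_nhds (s := Iio 0))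
  filter_upwards [h3, self_mem_nhdsWithin] with r hr hr0
  have hr0' : r < 0 := hr0
  rw [slope_def_field]
  have := hr hr0'.le
  apply div_nonneg_of_nonpos
  · simpa using this
  · simpa using hr0'.le

end DirD

lemma bernstein_alg {n : ℕ} (h hτ : ℝ) (hh : 0 < h) (a b F : Fin n → ℝ)
    (H T FF : Fin n → Fin n → ℝ)
    (E1 : h * hτ = ∑ i, (a i * a i + h * H i i - F i * (h * a i)))
    (E2 : ∀ j, a j * hτ + h * b j = ∑ i, (2 * a i * H i j + (a j * H i i + h * T i j)
        - (FF i j * (h * a i) + F i * (a j * a i + h * H i j))))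
    (Q : 0 ≤ ∑ i, ∑ j, FF i j * a i * a j) :
    h ^ 2 * (∑ j, 2 * a j * b j) ≤ 2 * h * (∑ i, a i * ∑ j, 2 * a j * H i j)
      - 2 * (∑ j, a j ^ 2) ^ 2 + h ^ 2 * (∑ i, ∑ j, (2 * H i j ^ 2 + 2 * a j * T i j))
      - h ^ 2 * ∑ i, F i * ∑ j, 2 * a j * H i j := by
  set w := ∑ j, a j ^ 2 with hw
  have e1 : w * (h * hτ) = w * w + h * w * (∑ i, H i i) - h * w * ∑ i, F i * a i := by
    have : w = ∑ i, a i * a i := by rw [hw]; congr 1; ext; ring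
    rw [E1, Finset.sum_sub_distrib, Finset.sum_add_distrib, ← this, ← Finset.mul_sum]
    have e : ∑ i, F i * (h * a i) = h * ∑ i, F i * a i := by
      rw [Finset.mul_sum]; congr 1; ext; ring
    rw [e]; ring
  have e2 : w * hτ + h * ∑ j, a j * b j = (∑ i, a i * ∑ j, 2 * a j * H i j)
      + w * (∑ i, H i i) + h * (∑ i, ∑ j, a j * T i j) - h * (∑ i, ∑ j, FF i j * a i * a j)
      - w * (∑ i, F i * a i) - h * ∑ i, F i * ∑ j, a j * H i j := by
    have : w * hτ + h * ∑ j, a j * b j = ∑ j, a j * (a j * hτ + h * b j) := by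
      rw [hw, Finset.sum_mul, Finset.mul_sum, ← Finset.sum_add_distrib]
      congr 1; ext; ring
    rw [this]
    simp only [E2, hw, Finset.mul_sum, Finset.sum_mul]
    rw [Finset.sum_comm]
    rw [show (∑ i, ∑ j, a j ^ 2 * H i i) = ∑ i, ∑ j, a j ^ 2 * H i i from rfl]
    rw [← Finset.sum_add_distrib, ← Finset.sum_add_distrib, ← Finset.sum_sub_distrib, ← Finset.sum_sub_distrib, ← Finset.sum_sub_distrib]
    congr 1; ext i
    rw [← Finset.sum_add_distrib, ← Finset.sum_add_distrib, ← Finset.sum_sub_distrib, ← Finset.sum_sub_distrib, ← Finset.sum_sub_distrib]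
    congr 1; ext j
    ring
  have s1 : (∑ j, 2 * a j * b j) = 2 * ∑ j, a j * b j := by
    rw [Finset.mul_sum]; congr 1; ext; ring
  have s2 : (∑ i, ∑ j, (2 * H i j ^ 2 + 2 * a j * T i j))
      = 2 * (∑ i, ∑ j, H i j ^ 2) + 2 * ∑ i, ∑ j, a j * T i j := by
    simp only [Finset.mul_sum]
    rw [← Finset.sum_add_distrib]; congr 1; ext i
    rw [← Finset.sum_add_distrib]; congr 1; ext j; ring
  have s3 : (∑ i, F i * ∑ j, 2 * a j * H i j) = 2 * ∑ i, F i * ∑ j, a j * H i j := by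
    simp only [Finset.mul_sum]
    congr 1; ext i; congr 1; ext j; ring
  have s4 : 0 ≤ ∑ i, ∑ j, H i j ^ 2 :=
    Finset.sum_nonneg fun i _ => Finset.sum_nonneg fun j _ => sq_nonneg _
  rw [s1, s2, s3]
  have k1 : 0 ≤ h ^ 2 * ∑ i, ∑ j, H i j ^ 2 := by positivity
  have k2 : 0 ≤ h ^ 2 * ∑ i, ∑ j, FF i j * a i * a j := by positivity
  have e2' := congrArg (fun z => 2 * h * z) e2
  nlinarith [e2', e1, k1, k2]

lemma max_alg {n : ℕ} (h w wτ ψ ψτ : ℝ) (hw0 : 0 < w)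
    (a wi wii ψi ψii F : Fin n → ℝ) (hw : w = ∑ j, a j ^ 2)
    (B : h ^ 2 * wτ ≤ 2 * h * (∑ i, a i * wi i) - 2 * w ^ 2 + h ^ 2 * (∑ i, wii i)
      - h ^ 2 * ∑ i, F i * wi i)
    (hψ : 0 < ψ)
    (M1 : ∀ i, 2 * ψ * ψi i * w + ψ ^ 2 * wi i = 0)
    (M2 : ∀ i, 2 * ψi i ^ 2 * w + 2 * ψ * ψii i * w + 4 * ψ * ψi i * wi i + ψ ^ 2 * wii i ≤ 0)
    (M3 : 0 ≤ 2 * ψ * ψτ * w + ψ ^ 2 * wτ) :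
    ψ ^ 2 * w ≤ h ^ 2 * (10 * (∑ i, ψi i ^ 2)
      + 2 * ψ * (ψτ + ∑ i, (F i * ψi i - ψii i))) := by
  have m1 : ∀ i, ψ * wi i = - 2 * ψi i * w := by
    intro i
    have := M1 i
    have h2 : ψ * (ψ * wi i + 2 * ψi i * w) = 0 := by linarith
    rcases mul_eq_zero.1 h2 with h | h <;> linarith
  have m2 : ∀ i, ψ ^ 2 * wii i ≤ 6 * ψi i ^ 2 * w - 2 * ψ * ψii i * w := by
    intro i
    have e : 4 * ψ * ψi i * wi i = 4 * ψi i * (ψ * wi i) := by ring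
    have := M2 i
    rw [e, m1] at this
    linarith
  have t1 : ψ ^ 2 * (∑ i, a i * wi i) = - 2 * ψ * w * ∑ i, a i * ψi i := by
    rw [Finset.mul_sum, Finset.mul_sum]; congr 1; ext i
    linear_combination (ψ * a i) * m1 i
  have t2 : ψ ^ 2 * (∑ i, F i * wi i) = - 2 * ψ * w * ∑ i, F i * ψi i := by
    rw [Finset.mul_sum, Finset.mul_sum]; congr 1; ext i
    linear_combination (ψ * F i) * m1 i
  have t3 : ψ ^ 2 * (∑ i, wii i) ≤ 6 * w * (∑ i, ψi i ^ 2) - 2 * ψ * w * ∑ i, ψii i := by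
    simp only [Finset.mul_sum]
    rw [← Finset.sum_sub_distrib]
    apply Finset.sum_le_sum; intro i _
    have := m2 i
    linarith
  have t4 : - 4 * h * ψ * (∑ i, a i * ψi i) ≤ ψ ^ 2 * w + 4 * h ^ 2 * ∑ i, ψi i ^ 2 := by
    rw [hw]
    simp only [Finset.mul_sum]
    rw [← Finset.sum_add_distrib]
    apply Finset.sum_le_sum; intro i _
    nlinarith [sq_nonneg (ψ * a i + 2 * h * ψi i)]
  rw [Finset.sum_sub_distrib]
  have B' := mul_le_mul_of_nonneg_left B (sq_nonneg ψ)
  have M3' := mul_le_mul_of_nonneg_left M3 (sq_nonneg h)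
  have t3' := mul_le_mul_of_nonneg_left t3 (sq_nonneg h)
  have t4' := mul_le_mul_of_nonneg_left t4 hw0.le
  have t1' := congrArg (fun z => 2 * h * z) t1
  have t2' := congrArg (fun z => h ^ 2 * z) t2
  refine le_of_mul_le_mul_left ?_ hw0
  nlinarith

section ST
variable {n : ℕ}

/-- spatial unit vectors in space-time -/
def eS (i : Fin n) : EuclideanSpace ℝ (Fin n) × ℝ := (EuclideanSpace.single i 1, 0)

/-- time unit vector in space-time -/
def eT : EuclideanSpace ℝ (Fin n) × ℝ := (0, 1)

/-- negative times -/
def negT (n : ℕ) : Set (EuclideanSpace ℝ (Fin n) × ℝ) := {p | p.2 < 0}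

lemma negT_open : IsOpen (negT n) := isOpen_lt continuous_snd continuous_const

/-- partial derivatives of the weight, as functions on space-time -/
def wF (f : EuclideanSpace ℝ (Fin n) → ℝ) (i : Fin n) (p : EuclideanSpace ℝ (Fin n) × ℝ) : ℝ :=
  fderiv ℝ f p.1 (EuclideanSpace.single i 1)

lemma slice_fst {G : EuclideanSpace ℝ (Fin n) × ℝ → ℝ} {x : EuclideanSpace ℝ (Fin n)} {t : ℝ}
    (hG : DifferentiableAt ℝ G (x, t)) (v : EuclideanSpace ℝ (Fin n)) :
    fderiv ℝ (fun y => G (y, t)) x v = dirD (v, 0) G (x, t) := by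
  have h1 : HasFDerivAt (fun y : EuclideanSpace ℝ (Fin n) => (y, t))
      (ContinuousLinearMap.inl ℝ (EuclideanSpace ℝ (Fin n)) ℝ) x := by
    exact hasFDerivAt_prodMk_left x t
  have := HasFDerivAt.comp x hG.hasFDerivAt h1
  unfold dirD
  have h2 : fderiv ℝ (fun y => G (y, t)) x = _ := this.fderiv
  rw [h2]; simp

lemma slice_snd {G : EuclideanSpace ℝ (Fin n) × ℝ → ℝ} {x : EuclideanSpace ℝ (Fin n)} {t : ℝ}
    (hG : DifferentiableAt ℝ G (x, t)) :
    deriv (fun s => G (x, s)) t = dirD eT G (x, t) := by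
  have h1 : HasFDerivAt (fun s : ℝ => (x, s))
      (ContinuousLinearMap.inr ℝ (EuclideanSpace ℝ (Fin n)) ℝ) t := by
    exact hasFDerivAt_prodMk_right x t
  have := (HasFDerivAt.comp t hG.hasFDerivAt h1).hasDerivAt
  unfold dirD eT
  have h2 : deriv (fun s => G (x, s)) t = _ := this.deriv
  rw [h2]; simp

lemma inner_grad (f g : EuclideanSpace ℝ (Fin n) → ℝ) (x : EuclideanSpace ℝ (Fin n)) :
    ⟪gradient f x, gradient g x⟫ = ∑ i, fderiv ℝ f x (EuclideanSpace.single i 1)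
      * fderiv ℝ g x (EuclideanSpace.single i 1) := by
  have key : ∀ (k : EuclideanSpace ℝ (Fin n) → ℝ) (i : Fin n),
      fderiv ℝ k x (EuclideanSpace.single i 1) = gradient k x i := by
    intro k i
    rw [← toDual_gradient, InnerProductSpace.toDual_apply_apply, EuclideanSpace.inner_single_right]
    simp
  simp only [key]
  rw [PiLp.inner_apply]
  simp [mul_comm]

lemma wF_smooth {f : EuclideanSpace ℝ (Fin n) → ℝ} (hf : ContDiff ℝ (⊤ : ℕ∞) f) (i : Fin n) :
    ContDiff ℝ (⊤ : ℕ∞) (wF f i) := by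
  have h1 : ContDiff ℝ (⊤ : ℕ∞) (fderiv ℝ f) := hf.fderiv_right (by norm_cast)
  exact (h1.comp contDiff_fst).clm_apply contDiff_const

lemma heat_coord {f : EuclideanSpace ℝ (Fin n) → ℝ}
    {U : EuclideanSpace ℝ (Fin n) × ℝ → ℝ} (hU : ContDiffOn ℝ (⊤ : ℕ∞) U (negT n))
    (heq : ∀ (x : EuclideanSpace ℝ (Fin n)), ∀ t < (0 : ℝ),
      deriv (fun s => U (x, s)) t = fLap f (fun y => U (y, t)) x)
    {p : EuclideanSpace ℝ (Fin n) × ℝ} (hp : p ∈ negT n) :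
    dirD eT U p = ∑ i, (dirD (eS i) (dirD (eS i) U) p - wF f i p * dirD (eS i) U p) := by
  obtain ⟨x, t⟩ := p
  have ht : t < 0 := hp
  have hd : ∀ y, DifferentiableAt ℝ U (y, t) := fun y => smooth_diffAt negT_open hU ht
  have e1 := heq x t ht
  rw [slice_snd (hd x)] at e1
  rw [e1]
  unfold fLap eLap
  rw [inner_grad, ← Finset.sum_sub_distrib]
  congr 1; ext i
  have e2 : (fun y => fderiv ℝ (fun y => U (y, t)) y (EuclideanSpace.single i 1))
      = fun y => dirD (eS i) U (y, t) := by
    ext y; exact slice_fst (hd y) _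
  rw [e2, slice_fst (smooth_diffAt negT_open (dirD_smooth negT_open hU _) ht),
    slice_fst (hd x)]
  rfl

lemma dirD_prodsq {S : Set (EuclideanSpace ℝ (Fin n) × ℝ)} (hS : IsOpen S)
    {ψ w : EuclideanSpace ℝ (Fin n) × ℝ → ℝ} (hψ : ContDiffOn ℝ (⊤ : ℕ∞) ψ S)
    (hw : ContDiffOn ℝ (⊤ : ℕ∞) w S) (v : EuclideanSpace ℝ (Fin n) × ℝ) {p} (hp : p ∈ S) :
    dirD v (fun q => ψ q * ψ q * w q) p = 2 * ψ p * dirD v ψ p * w p + ψ p ^ 2 * dirD v w p := by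
  have h1 := smooth_diffAt hS hψ hp
  have h2 := smooth_diffAt hS hw hp
  rw [dirD_mul (h1.fun_mul h1) h2, dirD_mul h1 h1]; ring

lemma dirD_prodsq2 {S : Set (EuclideanSpace ℝ (Fin n) × ℝ)} (hS : IsOpen S)
    {ψ w : EuclideanSpace ℝ (Fin n) × ℝ → ℝ} (hψ : ContDiffOn ℝ (⊤ : ℕ∞) ψ S)
    (hw : ContDiffOn ℝ (⊤ : ℕ∞) w S) (v : EuclideanSpace ℝ (Fin n) × ℝ) {p} (hp : p ∈ S) :
    dirD v (dirD v (fun q => ψ q * ψ q * w q)) p = 2 * dirD v ψ p ^ 2 * w p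
      + 2 * ψ p * dirD v (dirD v ψ) p * w p + 4 * ψ p * dirD v ψ p * dirD v w p
      + ψ p ^ 2 * dirD v (dirD v w) p := by
  have e : ∀ q ∈ S, dirD v (fun q => ψ q * ψ q * w q) q
      = (ψ q * dirD v ψ q) * w q + (ψ q * dirD v ψ q) * w q + ψ q * ψ q * dirD v w q := by
    intro q hq
    rw [dirD_prodsq hS hψ hw v hq]; ring
  rw [dirD_congr hS e v hp]
  have h1 := smooth_diffAt hS hψ hp
  have h2 := smooth_diffAt hS hw hp
  have h3 := smooth_diffAt hS (dirD_smooth hS hψ v) hp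
  have h4 := smooth_diffAt hS (dirD_smooth hS hw v) hp
  rw [dirD_add (((h1.fun_mul h3).fun_mul h2).fun_add ((h1.fun_mul h3).fun_mul h2))
      ((h1.fun_mul h1).fun_mul h4),
    dirD_add ((h1.fun_mul h3).fun_mul h2) ((h1.fun_mul h3).fun_mul h2),
    dirD_mul (h1.fun_mul h3) h2, dirD_mul h1 h3, dirD_mul (h1.fun_mul h1) h4, dirD_mul h1 h1]
  ring

/-- equation of the square root -/
lemma sqrt_eq {f : EuclideanSpace ℝ (Fin n) → ℝ}
    {U h : EuclideanSpace ℝ (Fin n) × ℝ → ℝ}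
    (hh : ContDiffOn ℝ (⊤ : ℕ∞) h (negT n))
    (hUh : ∀ p ∈ negT n, U p = h p * h p)
    (heq : ∀ p ∈ negT n,
      dirD eT U p = ∑ i, (dirD (eS i) (dirD (eS i) U) p - wF f i p * dirD (eS i) U p))
    {p : EuclideanSpace ℝ (Fin n) × ℝ} (hp : p ∈ negT n) :
    h p * dirD eT h p = ∑ i, (dirD (eS i) h p * dirD (eS i) h p
      + h p * dirD (eS i) (dirD (eS i) h) p - wF f i p * (h p * dirD (eS i) h p)) := by
  have d1 : ∀ v, ∀ q ∈ negT n, dirD v U q = h q * dirD v h q + h q * dirD v h q := by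
    intro v q hq
    have := smooth_diffAt negT_open hh hq
    rw [dirD_congr negT_open hUh v hq, dirD_mul this this]; ring
  have d2 : ∀ v, dirD v (dirD v U) p = 2 * (dirD v h p * dirD v h p + h p * dirD v (dirD v h) p) := by
    intro v
    have h1 := smooth_diffAt negT_open hh hp
    have h2 := smooth_diffAt negT_open (dirD_smooth negT_open hh v) hp
    rw [dirD_congr negT_open (d1 v) v hp, dirD_add (h1.fun_mul h2) (h1.fun_mul h2), dirD_mul h1 h2]
    ring
  have e := heq p hp
  rw [d1 _ p hp] at e
  have : h p * dirD eT h p = (1/2) * (h p * dirD eT h p + h p * dirD eT h p) := by ring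
  rw [this, e, Finset.mul_sum]
  congr 1; ext i
  rw [d2, d1 _ p hp]; ring

lemma sqrt_eq_deriv {f : EuclideanSpace ℝ (Fin n) → ℝ} (hf : ContDiff ℝ (⊤ : ℕ∞) f)
    {h : EuclideanSpace ℝ (Fin n) × ℝ → ℝ}
    (hh : ContDiffOn ℝ (⊤ : ℕ∞) h (negT n))
    (heq : ∀ p ∈ negT n, h p * dirD eT h p = ∑ i, (dirD (eS i) h p * dirD (eS i) h p
      + h p * dirD (eS i) (dirD (eS i) h) p - wF f i p * (h p * dirD (eS i) h p)))
    {p : EuclideanSpace ℝ (Fin n) × ℝ} (hp : p ∈ negT n) (j : Fin n) :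
    dirD (eS j) h p * dirD eT h p + h p * dirD eT (dirD (eS j) h) p =
      ∑ i, (2 * dirD (eS i) h p * dirD (eS i) (dirD (eS j) h) p
        + (dirD (eS j) h p * dirD (eS i) (dirD (eS i) h) p
          + h p * dirD (eS i) (dirD (eS i) (dirD (eS j) h)) p)
        - (dirD (eS j) (wF f i) p * (h p * dirD (eS i) h p)
          + wF f i p * (dirD (eS j) h p * dirD (eS i) h p
            + h p * dirD (eS i) (dirD (eS j) h) p))) := by
  have hO := negT_open (n := n)
  have e := dirD_congr hO heq (eS j) hp
  have h0 := smooth_diffAt hO hh hp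
  have h1 : ∀ v, DifferentiableAt ℝ (dirD v h) p :=
    fun v => smooth_diffAt hO (dirD_smooth hO hh v) hp
  have h2 : ∀ v w, DifferentiableAt ℝ (dirD v (dirD w h)) p :=
    fun v w => smooth_diffAt hO (dirD_smooth hO (dirD_smooth hO hh w) v) hp
  have hF : ∀ i, DifferentiableAt ℝ (wF f i) p :=
    fun i => ((wF_smooth hf i).differentiable (by simp)).differentiableAt
  rw [dirD_mul h0 (h1 _), dirD_comm hO hh (eS j) eT hp, dirD_sum] at e
  · rw [e]
    congr 1; ext i
    rw [dirD_sub (((h1 _).fun_mul (h1 _)).fun_add (h0.fun_mul (h2 _ _)))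
        ((hF i).fun_mul (h0.fun_mul (h1 _))),
      dirD_add ((h1 _).fun_mul (h1 _)) (h0.fun_mul (h2 _ _)),
      dirD_mul (h1 _) (h1 _), dirD_mul h0 (h2 _ _), dirD_mul (hF i) (h0.fun_mul (h1 _)),
      dirD_mul h0 (h1 _), dirD_comm hO hh (eS j) (eS i) hp,
      dirD_comm hO (dirD_smooth hO hh (eS i)) (eS j) (eS i) hp,
      dirD_congr hO (fun q hq => dirD_comm hO hh (eS j) (eS i) hq) (eS i) hp]
    ring
  · intro i
    exact (((h1 _).fun_mul (h1 _)).fun_add (h0.fun_mul (h2 _ _))).fun_sub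
        ((hF i).fun_mul (h0.fun_mul (h1 _)))

/-- squared spatial gradient -/
def gradSq (h : EuclideanSpace ℝ (Fin n) × ℝ → ℝ) (p : EuclideanSpace ℝ (Fin n) × ℝ) : ℝ :=
  ∑ j, dirD (eS j) h p * dirD (eS j) h p

lemma gradSq_smooth {h : EuclideanSpace ℝ (Fin n) × ℝ → ℝ}
    (hh : ContDiffOn ℝ (⊤ : ℕ∞) h (negT n)) : ContDiffOn ℝ (⊤ : ℕ∞) (gradSq h) (negT n) := by
  unfold gradSq
  exact ContDiffOn.sum fun j _ => (dirD_smooth negT_open hh _).mul (dirD_smooth negT_open hh _)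

lemma gradSq_dirD {h : EuclideanSpace ℝ (Fin n) × ℝ → ℝ}
    (hh : ContDiffOn ℝ (⊤ : ℕ∞) h (negT n)) (v : EuclideanSpace ℝ (Fin n) × ℝ)
    {p : EuclideanSpace ℝ (Fin n) × ℝ} (hp : p ∈ negT n) :
    dirD v (gradSq h) p = ∑ j, 2 * dirD (eS j) h p * dirD v (dirD (eS j) h) p := by
  have h1 : ∀ v, DifferentiableAt ℝ (dirD v h) p :=
    fun v => smooth_diffAt negT_open (dirD_smooth negT_open hh v) hp
  unfold gradSq
  rw [dirD_sum (fun j => (h1 _).fun_mul (h1 _))]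
  congr 1; ext j
  rw [dirD_mul (h1 _) (h1 _)]; ring

lemma gradSq_dirD2 {h : EuclideanSpace ℝ (Fin n) × ℝ → ℝ}
    (hh : ContDiffOn ℝ (⊤ : ℕ∞) h (negT n)) (v : EuclideanSpace ℝ (Fin n) × ℝ)
    {p : EuclideanSpace ℝ (Fin n) × ℝ} (hp : p ∈ negT n) :
    dirD v (dirD v (gradSq h)) p = ∑ j, (2 * dirD v (dirD (eS j) h) p ^ 2
      + 2 * dirD (eS j) h p * dirD v (dirD v (dirD (eS j) h)) p) := by
  have hO := negT_open (n := n)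
  have h1 : ∀ v, DifferentiableAt ℝ (dirD v h) p :=
    fun v => smooth_diffAt hO (dirD_smooth hO hh v) hp
  have h2 : ∀ v w, DifferentiableAt ℝ (dirD v (dirD w h)) p :=
    fun v w => smooth_diffAt hO (dirD_smooth hO (dirD_smooth hO hh w) v) hp
  have hc : ∀ c : ℝ, DifferentiableAt ℝ (fun _ : EuclideanSpace ℝ (Fin n) × ℝ => c) p :=
    fun c => differentiableAt_const c
  rw [dirD_congr hO (fun q hq => gradSq_dirD hh v hq) v hp,
    dirD_sum (fun j => ((hc 2).fun_mul (h1 _)).fun_mul (h2 _ _))]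
  congr 1; ext j
  rw [dirD_mul ((hc 2).fun_mul (h1 _)) (h2 _ _), dirD_mul (hc 2) (h1 _), dirD_const]; ring

lemma hess_sum {f : EuclideanSpace ℝ (Fin n) → ℝ} (hf : ContDiff ℝ (⊤ : ℕ∞) f)
    (hconv : ∀ x v : EuclideanSpace ℝ (Fin n), 0 ≤ hessQF f x v)
    (p : EuclideanSpace ℝ (Fin n) × ℝ) (a : Fin n → ℝ) :
    0 ≤ ∑ i, ∑ j, dirD (eS j) (wF f i) p * a i * a j := by
  have hc := hconv p.1 (∑ i, a i • EuclideanSpace.single i 1)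
  unfold hessQF at hc
  obtain ⟨x, t⟩ := p
  have hd : ∀ i : Fin n, DifferentiableAt ℝ (fun y => fderiv ℝ f y (EuclideanSpace.single i 1)) x := by
    intro i
    have h1 : ContDiff ℝ (⊤ : ℕ∞) (fderiv ℝ f) := hf.fderiv_right (by norm_cast)
    exact ((h1.clm_apply contDiff_const).differentiable (by simp)).differentiableAt
  have e : (fun y => fderiv ℝ f y (∑ i, a i • EuclideanSpace.single i 1))
      = fun y => ∑ i, a i * fderiv ℝ f y (EuclideanSpace.single i 1) := by
    ext y; simp
  rw [e, fderiv_fun_sum (fun i _ => (hd i).const_mul _)] at hc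
  simp only [map_sum, map_smul, sum_apply, smul_eq_mul, Finset.mul_sum] at hc
  rw [Finset.sum_comm] at hc
  refine hc.trans_eq (Finset.sum_congr rfl fun i _ => Finset.sum_congr rfl fun j _ => ?_)
  have e2 := slice_fst (G := wF f i) (x := x) (t := t)
    ((wF_smooth hf i).differentiable (by simp)).differentiableAt (EuclideanSpace.single j 1)
  unfold eS
  rw [← e2, fderiv_const_mul (hd i)]
  simp only [wF, smul_apply, smul_eq_mul]
  ring

end ST

section Cut
variable {n : ℕ}

/-- cutoff function -/
def cutF (R t₁ : ℝ) (x₀ : EuclideanSpace ℝ (Fin n)) (q : EuclideanSpace ℝ (Fin n) × ℝ) : ℝ :=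
  1 - ‖q.1 - x₀‖ ^ 2 / R ^ 2 + (q.2 - t₁) / R

lemma cutF_smooth (R t₁ : ℝ) (x₀ : EuclideanSpace ℝ (Fin n)) :
    ContDiff ℝ (⊤ : ℕ∞) (cutF R t₁ x₀) := by
  unfold cutF
  exact (contDiff_const.sub (((contDiff_fst.sub contDiff_const).norm_sq ℝ).div_const _)).add
    ((contDiff_snd.sub contDiff_const).div_const _)

lemma cutF_dS (R t₁ : ℝ) (x₀ : EuclideanSpace ℝ (Fin n)) (i : Fin n)
    (p : EuclideanSpace ℝ (Fin n) × ℝ) :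
    dirD (eS i) (cutF R t₁ x₀) p = -2 * (p.1 i - x₀ i) / R ^ 2 := by
  have h := dirD_line (g := cutF R t₁ x₀) (p := p) (v := eS i) 0
    ((cutF_smooth R t₁ x₀).differentiable (by simp)).differentiableAt
  have e : (fun r : ℝ => cutF R t₁ x₀ (p + r • eS i)) = fun r : ℝ =>
      cutF R t₁ x₀ p + (-2 * (p.1 i - x₀ i) / R ^ 2) * r - r ^ 2 / R ^ 2 := by
    ext r
    unfold cutF eS
    have : ‖p.1 + r • EuclideanSpace.single i (1 : ℝ) - x₀‖ ^ 2
        = ‖p.1 - x₀‖ ^ 2 + 2 * r * (p.1 i - x₀ i) + r ^ 2 := by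
      rw [add_sub_right_comm, norm_add_sq_real, real_inner_smul_right,
        EuclideanSpace.inner_single_right, norm_smul]
      simp
      ring
    simp only [Prod.fst_add, Prod.smul_fst, Prod.snd_add, Prod.smul_snd, smul_zero, add_zero]
    rw [this]; ring
  rw [e] at h
  have h2 : HasDerivAt (fun r : ℝ =>
      cutF R t₁ x₀ p + (-2 * (p.1 i - x₀ i) / R ^ 2) * r - r ^ 2 / R ^ 2)
      (-2 * (p.1 i - x₀ i) / R ^ 2) 0 := by
    have := (((hasDerivAt_id (0 : ℝ)).const_mul (-2 * (p.1 i - x₀ i) / R ^ 2)).const_add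
      (cutF R t₁ x₀ p)).sub (((hasDerivAt_id (0 : ℝ)).pow 2).div_const (R ^ 2))
    exact this.congr_deriv (by simp)
  simpa using h.unique h2

lemma cutF_dT (R t₁ : ℝ) (x₀ : EuclideanSpace ℝ (Fin n))
    (p : EuclideanSpace ℝ (Fin n) × ℝ) :
    dirD eT (cutF R t₁ x₀) p = 1 / R := by
  have h := dirD_line (g := cutF R t₁ x₀) (p := p) (v := eT) 0
    ((cutF_smooth R t₁ x₀).differentiable (by simp)).differentiableAt
  have e : (fun r : ℝ => cutF R t₁ x₀ (p + r • eT)) = fun r : ℝ =>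
      cutF R t₁ x₀ p + (1 / R) * r := by
    ext r
    unfold cutF eT
    simp only [Prod.fst_add, Prod.smul_fst, Prod.snd_add, Prod.smul_snd, smul_zero, add_zero,
      smul_eq_mul]
    ring
  rw [e] at h
  have h2 := ((hasDerivAt_id (0 : ℝ)).const_mul (1 / R)).const_add (cutF R t₁ x₀ p)
  have := h.unique h2
  simpa using this

lemma cutF_dSS (R t₁ : ℝ) (x₀ : EuclideanSpace ℝ (Fin n)) (i : Fin n)
    (p : EuclideanSpace ℝ (Fin n) × ℝ) :
    dirD (eS i) (dirD (eS i) (cutF R t₁ x₀)) p = -2 / R ^ 2 := by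
  have hs := dirD_smooth isOpen_univ (cutF_smooth R t₁ x₀).contDiffOn (eS i)
  have h := dirD_line (g := dirD (eS i) (cutF R t₁ x₀)) (p := p) (v := eS i) 0
    (smooth_diffAt isOpen_univ hs (mem_univ _))
  have e : (fun r : ℝ => dirD (eS i) (cutF R t₁ x₀) (p + r • eS i)) = fun r : ℝ =>
      -2 * (p.1 i - x₀ i) / R ^ 2 + (-2 / R ^ 2) * r := by
    ext r
    rw [cutF_dS]
    unfold eS
    simp
    ring
  rw [e] at h
  have h2 := ((hasDerivAt_id (0 : ℝ)).const_mul (-2 / R ^ 2)).const_add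
    (-2 * (p.1 i - x₀ i) / R ^ 2)
  have := h.unique h2
  simpa using this

lemma fderiv_mono {f : EuclideanSpace ℝ (Fin n) → ℝ} (hf : ContDiff ℝ (⊤ : ℕ∞) f)
    (hconv : ∀ x v : EuclideanSpace ℝ (Fin n), 0 ≤ hessQF f x v)
    (x x₀ : EuclideanSpace ℝ (Fin n)) :
    fderiv ℝ f x₀ (x - x₀) ≤ fderiv ℝ f x (x - x₀) := by
  set v := x - x₀ with hv
  have h1 : ContDiff ℝ (⊤ : ℕ∞) (fderiv ℝ f) := hf.fderiv_right (by norm_cast)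
  have hd : Differentiable ℝ (fun y => fderiv ℝ f y v) :=
    (h1.clm_apply contDiff_const).differentiable (by simp)
  have hl : ∀ s : ℝ, HasDerivAt (fun r : ℝ => fderiv ℝ f (x₀ + r • v) v)
      (hessQF f (x₀ + s • v) v) s := fun s =>
    dirD_line (g := fun y => fderiv ℝ f y v) (p := x₀) (v := v) s hd.differentiableAt
  have hm : Monotone (fun r : ℝ => fderiv ℝ f (x₀ + r • v) v) :=
    monotone_of_deriv_nonneg (fun s => (hl s).differentiableAt)
      (fun s => by rw [(hl s).deriv]; exact hconv _ _)
  have := hm (zero_le_one)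
  simpa [hv] using this

lemma sum_wF (f : EuclideanSpace ℝ (Fin n) → ℝ) (p : EuclideanSpace ℝ (Fin n) × ℝ)
    (v : EuclideanSpace ℝ (Fin n)) : ∑ i, wF f i p * v i = fderiv ℝ f p.1 v := by
  have : v = ∑ i, v i • EuclideanSpace.single i (1 : ℝ) := by
    ext k
    simp [Finset.sum_apply, Pi.single_apply]
  conv_rhs => rw [this]
  simp [wF, mul_comm]

lemma cut_bound {f : EuclideanSpace ℝ (Fin n) → ℝ} (hf : ContDiff ℝ (⊤ : ℕ∞) f)
    (hconv : ∀ x v : EuclideanSpace ℝ (Fin n), 0 ≤ hessQF f x v)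
    (x₀ : EuclideanSpace ℝ (Fin n)) {R t₁ : ℝ} (hR : 1 ≤ R)
    {p : EuclideanSpace ℝ (Fin n) × ℝ} (hp : 0 ≤ cutF R t₁ x₀ p) (hpt : p.2 ≤ t₁) :
    10 * (∑ i, dirD (eS i) (cutF R t₁ x₀) p ^ 2) + 2 * cutF R t₁ x₀ p *
      (dirD eT (cutF R t₁ x₀) p + ∑ i, (wF f i p * dirD (eS i) (cutF R t₁ x₀) p
        - dirD (eS i) (dirD (eS i) (cutF R t₁ x₀)) p))
      ≤ (42 + 4 * n + 4 * ‖fderiv ℝ f x₀‖) / R := by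
  have hR0 : 0 < R := by linarith
  set r := ‖p.1 - x₀‖ with hr
  have hr0 : 0 ≤ r := norm_nonneg _
  have htR : (p.2 - t₁) / R ≤ 0 := div_nonpos_of_nonpos_of_nonneg (by linarith) hR0.le
  have hψ1 : cutF R t₁ x₀ p ≤ 1 := by
    unfold cutF
    have : 0 ≤ r ^ 2 / R ^ 2 := by positivity
    linarith
  have hrR2 : r ^ 2 ≤ R ^ 2 := by
    unfold cutF at hp
    have : r ^ 2 / R ^ 2 ≤ 1 := by linarith
    rwa [div_le_one (by positivity)] at this
  have hrR : r ≤ R := abs_le_of_sq_le_sq' hrR2 hR0.le |>.2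
  have s1 : ∑ i, dirD (eS i) (cutF R t₁ x₀) p ^ 2 = 4 * r ^ 2 / R ^ 4 := by
    simp only [cutF_dS]
    rw [hr, EuclideanSpace.norm_sq_eq, Finset.mul_sum, Finset.sum_div]
    congr 1; ext i
    simp only [PiLp.sub_apply, Real.norm_eq_abs, sq_abs]
    ring
  have s1' : ∑ i, dirD (eS i) (cutF R t₁ x₀) p ^ 2 ≤ 4 / R := by
    rw [s1, div_le_div_iff₀ (by positivity) hR0]
    have : R ^ 3 ≤ R ^ 4 := pow_le_pow_right₀ hR (by norm_num)
    nlinarith [mul_le_mul_of_nonneg_right hrR2 hR0.le]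
  have s2 : ∑ i, (wF f i p * dirD (eS i) (cutF R t₁ x₀) p
        - dirD (eS i) (dirD (eS i) (cutF R t₁ x₀)) p)
      = (-2 * fderiv ℝ f p.1 (p.1 - x₀) + 2 * n) / R ^ 2 := by
    simp only [cutF_dS, cutF_dSS]
    rw [Finset.sum_sub_distrib, ← sum_wF, Finset.mul_sum, add_div, Finset.sum_div]
    simp only [Finset.sum_const, Finset.card_univ, Fintype.card_fin, nsmul_eq_mul]
    rw [sub_eq_add_neg]
    congr 1
    · congr 1; ext i
      simp only [PiLp.sub_apply]
      ring
    · ring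
  have hb : -(‖fderiv ℝ f x₀‖ * R) ≤ fderiv ℝ f p.1 (p.1 - x₀) := by
    have h1 := fderiv_mono hf hconv p.1 x₀
    have h2 := (fderiv ℝ f x₀).le_opNorm (p.1 - x₀)
    rw [Real.norm_eq_abs] at h2
    have h3 := (abs_le.1 h2).1
    have h4 : ‖fderiv ℝ f x₀‖ * r ≤ ‖fderiv ℝ f x₀‖ * R :=
      mul_le_mul_of_nonneg_left hrR (norm_nonneg _)
    linarith
  have s3 : dirD eT (cutF R t₁ x₀) p + ∑ i, (wF f i p * dirD (eS i) (cutF R t₁ x₀) p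
        - dirD (eS i) (dirD (eS i) (cutF R t₁ x₀)) p)
      ≤ (1 + 2 * n + 2 * ‖fderiv ℝ f x₀‖) / R := by
    rw [s2, cutF_dT]
    have : (-2 * fderiv ℝ f p.1 (p.1 - x₀) + 2 * n) / R ^ 2
        ≤ (2 * n + 2 * ‖fderiv ℝ f x₀‖) / R := by
      rw [div_le_div_iff₀ (by positivity) hR0]
      have hn : (0 : ℝ) ≤ n := Nat.cast_nonneg n
      have : -2 * fderiv ℝ f p.1 (p.1 - x₀) + 2 * n ≤ (2 * n + 2 * ‖fderiv ℝ f x₀‖) * R := by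
        nlinarith
      nlinarith
    have e : (1 + 2 * n + 2 * ‖fderiv ℝ f x₀‖) / R = 1 / R + (2 * n + 2 * ‖fderiv ℝ f x₀‖) / R := by
      ring
    rw [e]; linarith
  have s4 : 2 * cutF R t₁ x₀ p *
      (dirD eT (cutF R t₁ x₀) p + ∑ i, (wF f i p * dirD (eS i) (cutF R t₁ x₀) p
        - dirD (eS i) (dirD (eS i) (cutF R t₁ x₀)) p))
      ≤ 2 * ((1 + 2 * n + 2 * ‖fderiv ℝ f x₀‖) / R) := by
    have hq : 0 ≤ (1 + 2 * n + 2 * ‖fderiv ℝ f x₀‖) / R := by positivity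
    calc _ ≤ 2 * cutF R t₁ x₀ p * ((1 + 2 * n + 2 * ‖fderiv ℝ f x₀‖) / R) :=
          mul_le_mul_of_nonneg_left s3 (by linarith)
      _ ≤ _ := by nlinarith
  have e : (42 + 4 * n + 4 * ‖fderiv ℝ f x₀‖) / R
      = 10 * (4 / R) + 2 * ((1 + 2 * n + 2 * ‖fderiv ℝ f x₀‖) / R) := by ring
  rw [e]; linarith

lemma cut_region {x₀ : EuclideanSpace ℝ (Fin n)} {R t₁ : ℝ} (hR : 1 ≤ R)
    {p : EuclideanSpace ℝ (Fin n) × ℝ} (hp : 0 ≤ cutF R t₁ x₀ p) (hpt : p.2 ≤ t₁) :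
    ‖p.1 - x₀‖ ≤ R ∧ t₁ - R ≤ p.2 := by
  have hR0 : 0 < R := by linarith
  have htR : (p.2 - t₁) / R ≤ 0 := div_nonpos_of_nonpos_of_nonneg (by linarith) hR0.le
  have h0 : 0 ≤ ‖p.1 - x₀‖ ^ 2 / R ^ 2 := by positivity
  unfold cutF at hp
  constructor
  · have : ‖p.1 - x₀‖ ^ 2 / R ^ 2 ≤ 1 := by linarith
    rw [div_le_one (by positivity)] at this
    exact abs_le_of_sq_le_sq' this hR0.le |>.2
  · have : -1 ≤ (p.2 - t₁) / R := by linarith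
    rw [le_div_iff₀ hR0] at this
    linarith

lemma grad_est {f : EuclideanSpace ℝ (Fin n) → ℝ} (hf : ContDiff ℝ (⊤ : ℕ∞) f)
    (hconv : ∀ x v : EuclideanSpace ℝ (Fin n), 0 ≤ hessQF f x v)
    (x₀ : EuclideanSpace ℝ (Fin n)) {R t₁ D : ℝ} (hR : 1 ≤ R) (ht₁ : t₁ < 0)
    {h : EuclideanSpace ℝ (Fin n) × ℝ → ℝ}
    (hh : ContDiffOn ℝ (⊤ : ℕ∞) h (negT n)) (hpos : ∀ p ∈ negT n, 0 < h p)
    (heq : ∀ p ∈ negT n, h p * dirD eT h p = ∑ i, (dirD (eS i) h p * dirD (eS i) h p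
      + h p * dirD (eS i) (dirD (eS i) h) p - wF f i p * (h p * dirD (eS i) h p)))
    (hD : ∀ p, 0 ≤ cutF R t₁ x₀ p → p.2 ≤ t₁ → h p ^ 2 ≤ D)
    (q : EuclideanSpace ℝ (Fin n) × ℝ) (hq : 0 ≤ cutF R t₁ x₀ q) (hqt : q.2 ≤ t₁) :
    cutF R t₁ x₀ q * cutF R t₁ x₀ q * gradSq h q
      ≤ D * ((42 + 4 * n + 4 * ‖fderiv ℝ f x₀‖) / R) := by
  have hO := negT_open (n := n)
  have hR0 : 0 < R := by linarith
  set ψ := cutF R t₁ x₀ with hψdef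
  have hψs : ContDiff ℝ (⊤ : ℕ∞) ψ := cutF_smooth R t₁ x₀
  have hψO : ContDiffOn ℝ (⊤ : ℕ∞) ψ (negT n) := hψs.contDiffOn
  have hws := gradSq_smooth hh
  set G := fun q => ψ q * ψ q * gradSq h q with hG
  have hGs : ContDiffOn ℝ (⊤ : ℕ∞) G (negT n) := (hψO.mul hψO).mul hws
  let K : Set (EuclideanSpace ℝ (Fin n) × ℝ) := {p | 0 ≤ ψ p ∧ p.2 ≤ t₁}
  have hKS : K ⊆ negT n := fun p hp => lt_of_le_of_lt hp.2 ht₁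
  have hKc : IsCompact K := by
    have hcl : IsClosed K := (isClosed_le continuous_const hψs.continuous).inter
      (isClosed_le continuous_snd continuous_const)
    refine IsCompact.of_isClosed_subset
      ((isCompact_closedBall x₀ R).prod (isCompact_Icc (a := t₁ - R) (b := t₁))) hcl ?_
    intro p hp
    have := cut_region hR hp.1 hp.2
    refine ⟨?_, this.2, hp.2⟩
    rw [mem_closedBall, dist_eq_norm]; exact this.1
  obtain ⟨p, hpK, hpmax⟩ := hKc.exists_isMaxOn ⟨q, hq, hqt⟩ (hGs.continuousOn.mono hKS)
  have hmax : ∀ y ∈ K, G y ≤ G p := fun y hy => hpmax hy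
  have hpS := hKS hpK
  have hD0 : 0 ≤ D := le_trans (sq_nonneg _) (hD p hpK.1 hpK.2)
  have hC0 : 0 ≤ (42 + 4 * n + 4 * ‖fderiv ℝ f x₀‖) / R := by positivity
  refine (hmax q ⟨hq, hqt⟩).trans ?_
  have hw0 : 0 ≤ gradSq h p := Finset.sum_nonneg fun i _ => mul_self_nonneg _
  by_cases hw1 : gradSq h p = 0
  · simp only [hG, hw1, mul_zero]; positivity
  by_cases hψ1 : ψ p = 0
  · simp only [hG, hψ1, mul_zero, zero_mul]; positivity
  have hwp : 0 < gradSq h p := lt_of_le_of_ne hw0 (Ne.symm hw1)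
  have hψp : 0 < ψ p := lt_of_le_of_ne hpK.1 (Ne.symm hψ1)
  have hOψ : IsOpen {y | 0 < ψ y} := isOpen_lt continuous_const hψs.continuous
  have hspace : ∀ i : Fin n, ∀ᶠ r : ℝ in nhds 0, G (p + r • eS i) ≤ G p := by
    intro i
    filter_upwards [line_mem hOψ hψp (eS i)] with r hr
    refine hmax _ ⟨le_of_lt hr, ?_⟩
    simpa [eS] using hpK.2
  have htime : ∀ᶠ r : ℝ in nhds 0, r ≤ 0 → G (p + r • eT) ≤ G p := by
    filter_upwards [line_mem hOψ hψp eT] with r hr hr0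
    refine hmax _ ⟨le_of_lt hr, ?_⟩
    have := hpK.2
    simp [eT]
    linarith
  have M1 := fun i => dirD_max_first hO hGs hpS (hspace i)
  have M2 := fun i => dirD_max_second hO hGs hpS (hspace i)
  have M3 := dirD_max_left hO hGs hpS htime
  simp only [hG, dirD_prodsq hO hψO hws _ hpS] at M1 M3
  simp only [hG, dirD_prodsq2 hO hψO hws _ hpS] at M2
  have B := bernstein_alg (h p) (dirD eT h p) (hpos p hpS) (fun i => dirD (eS i) h p)
    (fun j => dirD eT (dirD (eS j) h) p) (fun i => wF f i p)
    (fun i j => dirD (eS i) (dirD (eS j) h) p)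
    (fun i j => dirD (eS i) (dirD (eS i) (dirD (eS j) h)) p)
    (fun i j => dirD (eS j) (wF f i) p) (heq p hpS)
    (fun j => sqrt_eq_deriv hf hh heq hpS j) (hess_sum hf hconv p _)
  have hwsq : gradSq h p = ∑ j, dirD (eS j) h p ^ 2 := by
    unfold gradSq; congr 1; ext; ring
  simp only [← gradSq_dirD hh _ hpS, ← gradSq_dirD2 hh _ hpS, ← hwsq] at B
  have key := max_alg (h p) (gradSq h p) (dirD eT (gradSq h) p) (ψ p) (dirD eT ψ p) hwp
    (fun i => dirD (eS i) h p) (fun i => dirD (eS i) (gradSq h) p)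
    (fun i => dirD (eS i) (dirD (eS i) (gradSq h)) p) (fun i => dirD (eS i) ψ p)
    (fun i => dirD (eS i) (dirD (eS i) ψ) p) (fun i => wF f i p) hwsq B hψp M1 M2 M3
  have cb := cut_bound hf hconv x₀ hR hpK.1 hpK.2
  calc G p = ψ p ^ 2 * gradSq h p := by simp only [hG]; ring
    _ ≤ _ := key
    _ ≤ h p ^ 2 * ((42 + 4 * n + 4 * ‖fderiv ℝ f x₀‖) / R) :=
        mul_le_mul_of_nonneg_left cb (sq_nonneg _)
    _ ≤ _ := mul_le_mul_of_nonneg_right (hD p hpK.1 hpK.2) hC0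

end Cut

/-- Liouville theorem for positive ancient solutions of the `f`-heat equation with
sublinear growth (Euclidean case of Theorem 1.2(iii)). -/
theorem ancient_fheat_liouville (n : ℕ) (hn : 1 ≤ n)
    (f : EuclideanSpace ℝ (Fin n) → ℝ) (hf : ContDiff ℝ (⊤ : ℕ∞) f)
    (hconv : ∀ x v : EuclideanSpace ℝ (Fin n), 0 ≤ hessQF f x v)
    (x₀ : EuclideanSpace ℝ (Fin n))
    (u : EuclideanSpace ℝ (Fin n) → ℝ → ℝ)
    (hu : ContDiffOn ℝ (⊤ : ℕ∞) (fun p : EuclideanSpace ℝ (Fin n) × ℝ => u p.1 p.2)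
      (univ ×ˢ Iic (0 : ℝ)))
    (hpos : ∀ (x : EuclideanSpace ℝ (Fin n)), ∀ t ≤ (0 : ℝ), 0 < u x t)
    (heq : ∀ (x : EuclideanSpace ℝ (Fin n)), ∀ t ≤ (0 : ℝ),
      deriv (fun s => u x s) t = fLap f (fun y => u y t) x)
    (hgrowth : ∀ ε > (0 : ℝ), ∃ M : ℝ, ∀ (x : EuclideanSpace ℝ (Fin n)), ∀ t ≤ (0 : ℝ),
      M ≤ ‖x - x₀‖ + |t| →
        u x t ≤ ε * (‖x - x₀‖ ^ ((1 : ℝ) / 2) + |t| ^ ((1 : ℝ) / 4)) ^ 2) :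
    ∀ (x x' : EuclideanSpace ℝ (Fin n)), ∀ t ≤ (0 : ℝ), ∀ t' ≤ (0 : ℝ),
      u x t = u x' t' := by
  have hO := negT_open (n := n)
  set U : EuclideanSpace ℝ (Fin n) × ℝ → ℝ := fun p => u p.1 p.2 with hUdef
  have hUS : ContDiffOn ℝ (⊤ : ℕ∞) U (negT n) :=
    hu.mono fun p hp => ⟨mem_univ _, mem_Iic.2 (le_of_lt hp)⟩
  have hUpos : ∀ p ∈ negT n, 0 < U p := fun p hp => hpos p.1 p.2 (le_of_lt hp)
  have hUeq : ∀ p ∈ negT n,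
      dirD eT U p = ∑ i, (dirD (eS i) (dirD (eS i) U) p - wF f i p * dirD (eS i) U p) :=
    fun p hp => heat_coord hUS (fun x t ht => heq x t ht.le) hp
  set h : EuclideanSpace ℝ (Fin n) × ℝ → ℝ := fun p => Real.sqrt (U p) with hhdef
  have hhS : ContDiffOn ℝ (⊤ : ℕ∞) h (negT n) := hUS.sqrt fun p hp => (hUpos p hp).ne'
  have hhpos : ∀ p ∈ negT n, 0 < h p := fun p hp => Real.sqrt_pos.2 (hUpos p hp)
  have hUh : ∀ p ∈ negT n, U p = h p * h p :=
    fun p hp => (Real.mul_self_sqrt (hUpos p hp).le).symm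
  have hheq := fun p hp => sqrt_eq (p := p) hhS hUh hUeq hp
  set C : ℝ := 42 + 4 * n + 4 * ‖fderiv ℝ f x₀‖ with hC
  have hC0 : 0 < C := by positivity
  -- growth in a usable form
  have hgr : ∀ ε > (0 : ℝ), ∃ B : ℝ, 0 ≤ B ∧ ∀ p : EuclideanSpace ℝ (Fin n) × ℝ, p.2 ≤ 0 →
      U p ≤ B + 2 * ε * (‖p.1 - x₀‖ + 1 + |p.2|) := by
    intro ε hε
    obtain ⟨M, hM⟩ := hgrowth ε hε
    obtain ⟨B, hB⟩ := ((isCompact_closedBall x₀ |M|).prod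
      (isCompact_Icc (a := -|M|) (b := 0))).exists_bound_of_continuousOn
      (f := U) (hu.continuousOn.mono fun p hp => ⟨mem_univ _, hp.2.2⟩)
    refine ⟨|B|, abs_nonneg _, fun p hp => ?_⟩
    have hn0 := norm_nonneg (p.1 - x₀)
    have ht0 := abs_nonneg p.2
    by_cases hpM : M ≤ ‖p.1 - x₀‖ + |p.2|
    · have h1 := hM p.1 p.2 hp hpM
      have ha : (‖p.1 - x₀‖ ^ ((1 : ℝ) / 2)) ^ 2 = ‖p.1 - x₀‖ := by
        rw [← Real.rpow_natCast, ← Real.rpow_mul hn0]; norm_num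
      have hb : (|p.2| ^ ((1 : ℝ) / 4)) ^ 2 ≤ 1 + |p.2| := by
        rw [← Real.rpow_natCast, ← Real.rpow_mul ht0]
        have e : (1 : ℝ) / 4 * ((2 : ℕ) : ℝ) = 1 / 2 := by norm_num
        rw [e, ← Real.sqrt_eq_rpow]
        rw [Real.sqrt_le_left (by linarith)]
        nlinarith
      set a := ‖p.1 - x₀‖ ^ ((1 : ℝ) / 2)
      set b := |p.2| ^ ((1 : ℝ) / 4)
      have hab : (a + b) ^ 2 ≤ 2 * (‖p.1 - x₀‖ + 1 + |p.2|) := by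
        nlinarith [sq_nonneg (a - b)]
      have h2 := mul_le_mul_of_nonneg_left hab hε.le
      have := abs_nonneg B
      calc U p ≤ ε * (a + b) ^ 2 := h1
        _ ≤ _ := by linarith
    · push Not at hpM
      have hle : ‖p.1 - x₀‖ ≤ |M| := by linarith [le_abs_self M]
      have hle2 : |p.2| ≤ |M| := by linarith [le_abs_self M]
      have hmem : p ∈ closedBall x₀ |M| ×ˢ Icc (-|M|) 0 := by
        refine ⟨?_, (abs_le.1 hle2).1, hp⟩
        rw [mem_closedBall, dist_eq_norm]; exact hle
      have h1 := hB p hmem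
      rw [Real.norm_eq_abs] at h1
      have : 0 ≤ 2 * ε * (‖p.1 - x₀‖ + 1 + |p.2|) := by positivity
      linarith [le_abs_self (U p), le_abs_self B]
  have hgrad : ∀ q ∈ negT n, gradSq h q = 0 := by
    intro q hq
    have hqt : q.2 < 0 := hq
    have hw0 : 0 ≤ gradSq h q := Finset.sum_nonneg fun i _ => mul_self_nonneg _
    refine le_antisymm ?_ hw0
    refine le_of_forall_pos_le_add fun δ hδ => ?_
    rw [zero_add]
    set ε := δ / (10 * C) with hε
    have hε0 : 0 < ε := by positivity
    obtain ⟨B, hB0, hB⟩ := hgr ε hε0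
    set r := ‖q.1 - x₀‖ with hr
    have hr0 : 0 ≤ r := norm_nonneg _
    set A := B + 2 * ε * (1 + |q.2|) with hA
    have hA0 : 0 ≤ A := by positivity
    set R := 1 + 2 * r + A / ε with hRdef
    have hAε : 0 ≤ A / ε := by positivity
    have hR1 : 1 ≤ R := by linarith
    have hR0 : 0 < R := by linarith
    have hRr : 2 * r ≤ R := by linarith
    have hRA : A ≤ ε * R := by
      have : A / ε ≤ R := by linarith
      rw [div_le_iff₀ hε0] at this
      linarith
    have hψq : cutF R q.2 x₀ q = 1 - r ^ 2 / R ^ 2 := by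
      unfold cutF; simp [hr]
    have hψ34 : 3 / 4 ≤ cutF R q.2 x₀ q := by
      rw [hψq]
      have : r ^ 2 / R ^ 2 ≤ 1 / 4 := by
        rw [div_le_div_iff₀ (by positivity) (by norm_num)]
        nlinarith
      linarith
    have hest := grad_est hf hconv x₀ (D := 5 * ε * R) hR1 hqt hhS hhpos hheq (by
      intro p hp hpt
      have hpS : p ∈ negT n := lt_of_le_of_lt hpt hqt
      have h1 := hB p (le_of_lt hpS)
      have h2 := cut_region hR1 hp hpt
      have h3 : |p.2| ≤ R + |q.2| := by
        rw [abs_of_neg hqt, abs_of_neg hpS]; linarith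
      have h4 : h p ^ 2 = U p := by rw [hUh p hpS]; ring
      rw [h4]
      have h5 : 2 * ε * (‖p.1 - x₀‖ + 1 + |p.2|) ≤ 2 * ε * (R + 1 + (R + |q.2|)) := by
        apply mul_le_mul_of_nonneg_left _ (by positivity)
        linarith [h2.1]
      nlinarith) q (by linarith) le_rfl
    have e : 5 * ε * R * (C / R) = δ / 2 := by
      rw [hε]; field_simp; norm_num
    rw [e] at hest
    have h34 : 1 / 2 ≤ cutF R q.2 x₀ q * cutF R q.2 x₀ q := by nlinarith
    nlinarith [mul_le_mul_of_nonneg_right h34 hw0]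
  have hdh : ∀ q ∈ negT n, ∀ i, dirD (eS i) h q = 0 := by
    intro q hq i
    have h1 := hgrad q hq
    unfold gradSq at h1
    rw [Finset.sum_eq_zero_iff_of_nonneg (fun i _ => mul_self_nonneg _)] at h1
    exact mul_self_eq_zero.1 (h1 i (Finset.mem_univ _))
  have hdU : ∀ i, ∀ q ∈ negT n, dirD (eS i) U q = 0 := by
    intro i q hq
    have hd := smooth_diffAt hO hhS hq
    rw [dirD_congr hO hUh _ hq, dirD_mul hd hd, hdh q hq i]; ring
  have hdT : ∀ q ∈ negT n, dirD eT U q = 0 := by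
    intro q hq
    rw [hUeq q hq]
    apply Finset.sum_eq_zero
    intro i _
    rw [dirD_congr hO (hdU i) (eS i) hq, dirD_const, hdU i q hq]; ring
  have hfd : ∀ q ∈ negT n, fderiv ℝ U q = 0 := by
    intro q hq
    ext i
    · have e : ((i, 0) : EuclideanSpace ℝ (Fin n) × ℝ) = ∑ k, i k • eS k := by
        refine Prod.ext ?_ ?_
        · rw [Prod.fst_sum]
          ext k
          simp [eS, Finset.sum_apply, Pi.single_apply]
        · rw [Prod.snd_sum]
          simp [eS]
      have e2 : fderiv ℝ U q (i, 0) = 0 := by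
        rw [e, map_sum]
        refine Finset.sum_eq_zero fun k _ => ?_
        have h0 : fderiv ℝ U q (eS k) = 0 := hdU k q hq
        rw [map_smul, h0, smul_zero]
      simpa using e2
    · simpa [dirD, eT] using hdT q hq
  have hconvS : Convex ℝ (negT n) := by
    have : negT n = univ ×ˢ Iio (0 : ℝ) := by ext p; simp [negT]
    rw [this]
    exact convex_univ.prod (convex_Iio 0)
  have hconst : ∀ p ∈ negT n, ∀ q ∈ negT n, U p = U q := by
    intro p hp q hq
    exact hO.is_const_of_fderiv_eq_zero hconvS.isPreconnected
      (hUS.differentiableOn (by simp)) (fun x hx => hfd x hx) hp hq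
  have hall : ∀ x : EuclideanSpace ℝ (Fin n), ∀ t ≤ (0 : ℝ), U (x, t) = U (0, -1) := by
    intro x t ht
    have hm1 : ((0 : EuclideanSpace ℝ (Fin n)), (-1 : ℝ)) ∈ negT n := by
      show (-1 : ℝ) < 0
      norm_num
    have hcw : ContinuousWithinAt (fun s : ℝ => U (x, s)) (Iio t) t := by
      have h1 : ContinuousOn (fun s : ℝ => U (x, s)) (Iic 0) :=
        hu.continuousOn.comp (by fun_prop) (fun s hs => ⟨mem_univ _, hs⟩)
      exact (h1 t ht).mono fun s hs => le_trans (le_of_lt hs) ht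
    have hc2 : Filter.Tendsto (fun s : ℝ => U (x, s)) (nhdsWithin t (Iio t))
        (nhds (U (0, -1))) := by
      refine tendsto_const_nhds.congr' ?_
      filter_upwards [self_mem_nhdsWithin] with s hs
      exact hconst _ hm1 _ (lt_of_lt_of_le hs ht)
    exact tendsto_nhds_unique hcw hc2
  intro x x' t ht t' ht'
  exact (hall x t ht).trans (hall x' t' ht').symm
end
end

section
/- Fix t₀ ∈ ℝ, T > 0 and R > 0. For any τ ∈ (t₀ − T, t₀], there exist a smooth function ψ̄ : [0,∞) × [t₀−T, t₀] → ℝ and a constant C > 0 (independent of τ, R, t₀, T) such that: (1) 0 ≤ ψ̄(r,t) ≤ 1 everywhere, and ψ̄ is supported in [0,R] × [t₀−T, t₀] (ψ̄(r,t) = 0 for r > R); (2) ψ̄(r,t) = 1 for all (r,t) ∈ [0, R/2] × [τ, t₀], and ∂ψ̄/∂r(r,t) = 0 for all (r,t) ∈ [0, R/2] × [t₀−T, t₀]; (3) |∂ψ̄/∂t(r,t)| ≤ C·ψ̄(r,t)^{1/2} / (τ − (t₀ − T)) for all (r,t), and ψ̄(r, t₀−T) = 0 for all r ≥ 0; (4)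 for each ε ∈ (0,1) there is a constant C_ε depending only on ε such that −C_ε·ψ̄(r,t)^{ε}/R ≤ ∂ψ̄/∂r(r,t) ≤ 0 and |∂²ψ̄/∂r²(r,t)| ≤ C_ε·ψ̄(r,t)^{ε}/R² for all (r,t). (This is the paper's Lemma 2.3, the Li-Yau-type space-time cutoff function.) -/
open Set

open Polynomial in
lemma aux_glue_bound (p : ℝ[X]) (ε : ℝ) (hε : ε ∈ Ioo (0 : ℝ) 1) :
    ∃ K : ℝ, 0 ≤ K ∧ ∀ x ∈ Icc (0 : ℝ) 1,
      |p.eval x⁻¹ * expNegInvGlue x| ≤ K * expNegInvGlue x ^ ε := by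
  obtain ⟨h0, h1⟩ := hε
  have hd : 0 < 1 - ε := by linarith
  have hc := expNegInvGlue.continuous_polynomial_eval_inv_mul
    (p.comp (C ((1 - ε)⁻¹) * X))
  obtain ⟨K, hK⟩ := (isCompact_Icc (a := (0 : ℝ)) (b := (1 - ε)⁻¹)).exists_bound_of_continuousOn
    hc.continuousOn
  refine ⟨|K|, abs_nonneg _, fun x hx => ?_⟩
  rcases hx.1.eq_or_lt with h | hx0
  · subst h
    simp [Real.zero_rpow h0.ne']
  have hy := hK (x / (1 - ε)) ⟨by positivity, by
    rw [div_eq_mul_inv]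
    exact mul_le_of_le_one_left (by positivity) hx.2⟩
  have e1 : (p.comp (C ((1 - ε)⁻¹) * X)).eval (x / (1 - ε))⁻¹ = p.eval x⁻¹ := by
    rw [eval_comp]
    congr 1
    simp only [eval_mul, eval_C, eval_X]
    field_simp
  have hxd : 0 < x / (1 - ε) := by positivity
  have e2 : expNegInvGlue x = expNegInvGlue (x / (1 - ε)) * expNegInvGlue x ^ ε := by
    simp only [expNegInvGlue, not_le.2 hx0, not_le.2 hxd, if_false]
    rw [← Real.exp_mul, ← Real.exp_add]
    congr 1
    field_simp
    ring
  rw [e1, Real.norm_eq_abs] at hy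
  have hn : 0 ≤ expNegInvGlue x ^ ε := Real.rpow_nonneg (expNegInvGlue.nonneg _) _
  calc |p.eval x⁻¹ * expNegInvGlue x|
      = |p.eval x⁻¹ * expNegInvGlue (x / (1 - ε))| * expNegInvGlue x ^ ε := by
        conv_lhs => rw [e2]
        rw [← mul_assoc, abs_mul, abs_of_nonneg hn]
    _ ≤ |K| * expNegInvGlue x ^ ε := by
        exact mul_le_mul_of_nonneg_right (hy.trans (le_abs_self K)) hn

lemma aux_glue_le_one (x : ℝ) : expNegInvGlue x ≤ 1 := by
  unfold expNegInvGlue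
  split_ifs with h
  · exact zero_le_one
  · rw [Real.exp_le_one_iff]
    have : 0 < x⁻¹ := inv_pos.2 (not_le.1 h)
    linarith

lemma aux_glue_le (ε : ℝ) (hε : ε ∈ Ioo (0 : ℝ) 1) (x : ℝ) :
    expNegInvGlue x ^ ε ≤ 2 * Real.smoothTransition x ^ ε := by
  have h1 : expNegInvGlue x ≤ 2 * Real.smoothTransition x := by
    have hp := Real.smoothTransition.pos_denom x
    unfold Real.smoothTransition
    rw [← mul_div_assoc, le_div_iff₀ hp]
    nlinarith [aux_glue_le_one x, aux_glue_le_one (1 - x), expNegInvGlue.nonneg x]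
  have hS := Real.smoothTransition.nonneg x
  calc expNegInvGlue x ^ ε ≤ (2 * Real.smoothTransition x) ^ ε :=
        Real.rpow_le_rpow (expNegInvGlue.nonneg _) h1 hε.1.le
    _ = 2 ^ ε * Real.smoothTransition x ^ ε := Real.mul_rpow (by norm_num) hS
    _ ≤ 2 * Real.smoothTransition x ^ ε := by
        gcongr
        calc (2 : ℝ) ^ ε ≤ 2 ^ (1 : ℝ) :=
              Real.rpow_le_rpow_of_exponent_le (by norm_num) hε.2.le
          _ = 2 := by simp

open Polynomial in
lemma aux_transition_bound (ε : ℝ) (hε : ε ∈ Ioo (0 : ℝ) 1) :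
    ∃ K : ℝ, 0 < K ∧ ∀ x : ℝ,
      |deriv Real.smoothTransition x| ≤ K * Real.smoothTransition x ^ ε ∧
      |deriv (deriv Real.smoothTransition) x| ≤ K * Real.smoothTransition x ^ ε := by
  set P0 : ℝ[X] := 1 with hP0
  set P1 : ℝ[X] := X ^ 2 * (P0 - derivative P0) with hP1
  set P2 : ℝ[X] := X ^ 2 * (P1 - derivative P1) with hP2
  set h : ℝ → ℝ := fun x => (expNegInvGlue x + expNegInvGlue (1 - x))⁻¹ with hh
  have hsm : ContDiff ℝ 2 h := by
    have a : ContDiff ℝ 2 expNegInvGlue := expNegInvGlue.contDiff (n := 2)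
    exact (a.add (a.comp (contDiff_const.sub contDiff_id))).inv
      fun x => (Real.smoothTransition.pos_denom x).ne'
  have hsm1 : ContDiff ℝ 1 (deriv h) := by
    have : ContDiff ℝ (1 + 1) h := by simpa [one_add_one_eq_two] using hsm
    exact (contDiff_succ_iff_deriv.1 this).2.2
  have hsm2 : Continuous (deriv (deriv h)) := hsm1.continuous_deriv le_rfl
  have d0 : ∀ x, HasDerivAt h (deriv h x) x := fun x =>
    (hsm.differentiable (by norm_num) x).hasDerivAt
  have d1 : ∀ x, HasDerivAt (deriv h) (deriv (deriv h) x) x := fun x =>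
    (hsm1.differentiable (by norm_num) x).hasDerivAt
  have g0 := expNegInvGlue.hasDerivAt_polynomial_eval_inv_mul P0
  have g1 := expNegInvGlue.hasDerivAt_polynomial_eval_inv_mul P1
  have hS : Real.smoothTransition = fun x => (P0.eval x⁻¹ * expNegInvGlue x) * h x := by
    funext x
    simp [Real.smoothTransition, hP0, hh, div_eq_mul_inv]
  have hS1 : deriv Real.smoothTransition = fun x =>
      (P1.eval x⁻¹ * expNegInvGlue x) * h x
        + (P0.eval x⁻¹ * expNegInvGlue x) * deriv h x := by
    funext x
    rw [hS]
    exact ((g0 x).mul (d0 x)).deriv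
  have hS2 : deriv (deriv Real.smoothTransition) = fun x =>
      ((P2.eval x⁻¹ * expNegInvGlue x) * h x
        + (P1.eval x⁻¹ * expNegInvGlue x) * deriv h x)
      + ((P1.eval x⁻¹ * expNegInvGlue x) * deriv h x
        + (P0.eval x⁻¹ * expNegInvGlue x) * deriv (deriv h) x) := by
    funext x
    rw [hS1]
    exact (((g1 x).mul (d0 x)).add ((g0 x).mul (d1 x))).deriv
  obtain ⟨K0, hK0, b0⟩ := aux_glue_bound P0 ε hε
  obtain ⟨K1, hK1, b1⟩ := aux_glue_bound P1 ε hε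
  obtain ⟨K2, hK2, b2⟩ := aux_glue_bound P2 ε hε
  have hbd : ∀ f : ℝ → ℝ, Continuous f → ∃ M : ℝ, 0 ≤ M ∧ ∀ x ∈ Icc (0 : ℝ) 1, |f x| ≤ M := by
    intro f hf
    obtain ⟨M, hM⟩ := (isCompact_Icc (a := (0 : ℝ)) (b := 1)).exists_bound_of_continuousOn
      hf.continuousOn
    exact ⟨|M|, abs_nonneg _, fun x hx => (hM x hx).trans (le_abs_self M)⟩
  obtain ⟨M0, hM0, m0⟩ := hbd h hsm.continuous
  obtain ⟨M1, hM1, m1⟩ := hbd _ hsm1.continuous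
  obtain ⟨M2, hM2, m2⟩ := hbd _ hsm2
  set A := K1 * M0 + K0 * M1 with hA
  set B := (K2 * M0 + K1 * M1) + (K1 * M1 + K0 * M2) with hB
  have hA0 : 0 ≤ A := by positivity
  have hB0 : 0 ≤ B := by positivity
  refine ⟨2 * (A + B) + 1, by positivity, fun x => ?_⟩
  have hSn : 0 ≤ Real.smoothTransition x ^ ε :=
    Real.rpow_nonneg (Real.smoothTransition.nonneg x) ε
  have hrhs : 0 ≤ (2 * (A + B) + 1) * Real.smoothTransition x ^ ε := by positivity
  have hconst : ∀ c : ℝ, Real.smoothTransition =ᶠ[nhds x] (fun _ => c) →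
      deriv Real.smoothTransition x = 0 ∧ deriv (deriv Real.smoothTransition) x = 0 := by
    intro c hc
    have h1 := hc.deriv
    have h2 := h1.deriv
    refine ⟨?_, ?_⟩
    · rw [h1.eq_of_nhds]; simp
    · rw [h2.eq_of_nhds]; simp
  rcases lt_or_ge x 0 with hx | hx0
  · obtain ⟨e1, e2⟩ := hconst 0 (by
      filter_upwards [Iio_mem_nhds hx] with y hy
      exact Real.smoothTransition.zero_of_nonpos (le_of_lt hy))
    rw [e1, e2, abs_zero]
    exact ⟨hrhs, hrhs⟩
  rcases lt_or_ge 1 x with hx | hx1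
  · obtain ⟨e1, e2⟩ := hconst 1 (by
      filter_upwards [Ioi_mem_nhds hx] with y hy
      exact Real.smoothTransition.one_of_one_le (le_of_lt hy))
    rw [e1, e2, abs_zero]
    exact ⟨hrhs, hrhs⟩
  have hx : x ∈ Icc (0 : ℝ) 1 := ⟨hx0, hx1⟩
  set G := expNegInvGlue x ^ ε with hG
  have hGn : 0 ≤ G := Real.rpow_nonneg (expNegInvGlue.nonneg _) _
  have hGS : G ≤ 2 * Real.smoothTransition x ^ ε := aux_glue_le ε hε x
  have key : ∀ a b K M : ℝ, 0 ≤ K → |a| ≤ K * G → |b| ≤ M → |a * b| ≤ K * M * G := by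
    intro a b K M hK ha hb
    rw [abs_mul]
    calc |a| * |b| ≤ (K * G) * M := by gcongr
      _ = K * M * G := by ring
  have q10 := key _ _ _ _ hK1 (b1 x hx) (m0 x hx)
  have q01 := key _ _ _ _ hK0 (b0 x hx) (m1 x hx)
  have q20 := key _ _ _ _ hK2 (b2 x hx) (m0 x hx)
  have q11 := key _ _ _ _ hK1 (b1 x hx) (m1 x hx)
  have q02 := key _ _ _ _ hK0 (b0 x hx) (m2 x hx)
  constructor
  · rw [hS1]
    have : A * G ≤ (2 * (A + B) + 1) * Real.smoothTransition x ^ ε := by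
      nlinarith [mul_le_mul_of_nonneg_left hGS hA0, mul_nonneg hB0 hSn]
    refine ((abs_add_le _ _).trans (add_le_add q10 q01)).trans (le_trans (le_of_eq ?_) this)
    rw [hA]; ring
  · rw [hS2]
    have : B * G ≤ (2 * (A + B) + 1) * Real.smoothTransition x ^ ε := by
      nlinarith [mul_le_mul_of_nonneg_left hGS hB0, mul_nonneg hA0 hSn]
    refine ((abs_add_le _ _).trans (add_le_add ((abs_add_le _ _).trans (add_le_add q20 q11))
      ((abs_add_le _ _).trans (add_le_add q11 q02)))).trans (le_trans (le_of_eq ?_) this)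
    rw [hB]; ring



/-- Existence of the Li-Yau type space-time cutoff function (Lemma 2.3). -/
theorem cutoff_function_exists :
    ∃ C : ℝ, 0 < C ∧ ∃ Cε : ℝ → ℝ,
      ∀ (t₀ T R : ℝ), 0 < T → 0 < R →
        ∀ τ ∈ Ioc (t₀ - T) t₀,
          ∃ ψ : ℝ → ℝ → ℝ,
            ContDiff ℝ (⊤ : ℕ∞) (fun p : ℝ × ℝ => ψ p.1 p.2) ∧
            -- (1) values in [0,1], supported in [0,R] × [t₀−T,t₀]
            (∀ r ∈ Ici (0 : ℝ), ∀ t ∈ Icc (t₀ - T) t₀, ψ r t ∈ Icc (0 : ℝ) 1) ∧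
            (∀ r, R < r → ∀ t ∈ Icc (t₀ - T) t₀, ψ r t = 0) ∧
            -- (2) equal to 1 near the center, radially constant near the center
            (∀ r ∈ Icc (0 : ℝ) (R / 2), ∀ t ∈ Icc τ t₀, ψ r t = 1) ∧
            (∀ r ∈ Icc (0 : ℝ) (R / 2), ∀ t ∈ Icc (t₀ - T) t₀,
              deriv (fun s => ψ s t) r = 0) ∧
            -- (3) time-derivative bound and initial vanishing
            (∀ r ∈ Ici (0 : ℝ), ∀ t ∈ Icc (t₀ - T) t₀,
              |deriv (fun s => ψ r s) t| ≤ C * Real.sqrt (ψ r t) / (τ - (t₀ - T))) ∧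
            (∀ r ∈ Ici (0 : ℝ), ψ r (t₀ - T) = 0) ∧
            -- (4) radial-derivative bounds
            (∀ ε ∈ Ioo (0 : ℝ) 1, 0 < Cε ε ∧
              ∀ r ∈ Ici (0 : ℝ), ∀ t ∈ Icc (t₀ - T) t₀,
                (-(Cε ε) * ψ r t ^ ε / R ≤ deriv (fun s => ψ s t) r ∧
                  deriv (fun s => ψ s t) r ≤ 0) ∧
                |deriv (fun s => deriv (fun s' => ψ s' t) s) r| ≤
                  Cε ε * ψ r t ^ ε / R ^ 2) := by

  choose! K hK hKb using aux_transition_bound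
  have hhalf : (1 / 2 : ℝ) ∈ Ioo (0 : ℝ) 1 := by constructor <;> norm_num
  refine ⟨K (1 / 2), hK _ hhalf, fun ε => 4 * K ε, ?_⟩
  intro t₀ T R hT hR τ hτ
  set S := Real.smoothTransition with hSdef
  have hSc : ContDiff ℝ (⊤ : ℕ∞) S := Real.smoothTransition.contDiff
  have hS2 : ContDiff ℝ (1 + 1) S := Real.smoothTransition.contDiff (n := 1 + 1)
  have hS1 : ContDiff ℝ 1 (deriv S) := (contDiff_succ_iff_deriv.1 hS2).2.2
  have D0 : ∀ x, HasDerivAt S (deriv S x) x := fun x =>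
    (hS2.differentiable (by norm_num) x).hasDerivAt
  have D1 : ∀ x, HasDerivAt (deriv S) (deriv (deriv S) x) x := fun x =>
    (hS1.differentiable (by norm_num) x).hasDerivAt
  have hmono : ∀ x, 0 ≤ deriv S x := fun x => Real.smoothTransition.monotone.deriv_nonneg
  have hn : ∀ x, 0 ≤ S x := Real.smoothTransition.nonneg
  have hl : ∀ x, S x ≤ 1 := Real.smoothTransition.le_one
  set d := τ - (t₀ - T) with hd
  have hd0 : 0 < d := by have := hτ.1; linarith
  set u : ℝ → ℝ := fun r => 2 - 2 / R * r with hu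
  set v : ℝ → ℝ := fun t => (t - (t₀ - T)) / d with hv
  have Du : ∀ r, HasDerivAt u (-(2 / R)) r := fun r => by
    simpa using ((hasDerivAt_id r).const_mul (2 / R)).const_sub 2
  have Dv : ∀ t, HasDerivAt v (1 / d) t := fun t => by
    simpa using ((hasDerivAt_id t).sub_const (t₀ - T)).div_const d
  have e1 : ∀ t, deriv (fun s => S (u s) * S (v t)) =
      fun r => deriv S (u r) * (-(2 / R)) * S (v t) := fun t => by
    funext r
    exact (((D0 (u r)).comp r (Du r)).mul_const (S (v t))).deriv
  have e2 : ∀ t r, deriv (fun s => deriv (fun s' => S (u s') * S (v t)) s) r =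
      deriv (deriv S) (u r) * (-(2 / R)) * (-(2 / R)) * S (v t) := fun t r => by
    have : (fun s => deriv (fun s' => S (u s') * S (v t)) s) =
        fun r => deriv S (u r) * (-(2 / R)) * S (v t) := e1 t
    rw [this]
    exact ((((D1 (u r)).comp r (Du r)).mul_const (-(2 / R))).mul_const (S (v t))).deriv
  have e3 : ∀ r t, deriv (fun s => S (u r) * S (v s)) t =
      S (u r) * (deriv S (v t) * (1 / d)) := fun r t =>
    (((D0 (v t)).comp t (Dv t)).const_mul (S (u r))).deriv
  have pw : ∀ ε ∈ Ioo (0 : ℝ) 1, ∀ x, S x ≤ S x ^ ε := fun ε hε x =>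
    Real.self_le_rpow_of_le_one (hn x) (hl x) hε.2.le
  have hu1 : ∀ r ≤ R / 2, 1 ≤ u r := fun r hr => by
    have : 2 / R * r ≤ 2 / R * (R / 2) := by gcongr
    have h2 : 2 / R * (R / 2) = 1 := by field_simp
    simp only [hu]; linarith
  have hder1 : ∀ x, 1 ≤ x → deriv S x = 0 := fun x hx => by
    have : IsLocalMax S x := Filter.Eventually.of_forall fun y => by
      rw [hSdef, Real.smoothTransition.one_of_one_le hx]; exact hl y
    exact this.deriv_eq_zero
  refine ⟨fun r t => S (u r) * S (v t), ?_, ?_, ?_, ?_, ?_, ?_, ?_, ?_⟩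
  · refine ContDiff.mul (hSc.comp ?_) (hSc.comp ?_)
    · simp only [hu]; fun_prop
    · simp only [hv]; fun_prop
  · intro r _ t _
    exact ⟨mul_nonneg (hn _) (hn _), mul_le_one₀ (hl _) (hn _) (hl _)⟩
  · intro r hr t _
    have : u r ≤ 0 := by
      have : 2 / R * R ≤ 2 / R * r := by gcongr
      have h2 : 2 / R * R = 2 := by field_simp
      simp only [hu]; linarith
    simp [hSdef, Real.smoothTransition.zero_of_nonpos this]
  · intro r hr t ht
    have h2 : 1 ≤ v t := by
      simp only [hv]
      rw [one_le_div hd0]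
      have := ht.1
      linarith
    simp [hSdef, Real.smoothTransition.one_of_one_le (hu1 r hr.2),
      Real.smoothTransition.one_of_one_le h2]
  · intro r hr t _
    simp only [e1, hder1 _ (hu1 r hr.2), zero_mul]
  · intro r _ t _
    simp only [e3]
    have hb := (hKb _ hhalf (v t)).1
    have hp := pw _ hhalf (u r)
    have hk := hK _ hhalf
    rw [Real.sqrt_eq_rpow, Real.mul_rpow (hn _) (hn _), abs_mul, abs_mul, abs_of_nonneg (hn _),
      abs_of_pos (one_div_pos.2 hd0)]
    calc S (u r) * (|deriv S (v t)| * (1 / d))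
        ≤ S (u r) ^ (1 / 2 : ℝ) * ((K (1 / 2) * S (v t) ^ (1 / 2 : ℝ)) * (1 / d)) := by
          have := Real.rpow_nonneg (hn (u r)) (1 / 2)
          gcongr
      _ = _ := by ring
  · intro r _
    have : v (t₀ - T) = 0 := by simp [hv]
    simp [this, hSdef]
  · intro ε hε
    have hk := hK ε hε
    refine ⟨by positivity, fun r _ t _ => ?_⟩
    obtain ⟨hb1, hb2⟩ := hKb ε hε (u r)
    have hp := pw ε hε (v t)
    have hp1 := Real.rpow_nonneg (hn (u r)) ε
    have hp2 := Real.rpow_nonneg (hn (v t)) ε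
    have hSv := hn (v t)
    have hm := hmono (u r)
    simp only [e2]
    simp only [e1]
    rw [Real.mul_rpow (hn _) (hn _)]
    refine ⟨⟨?_, ?_⟩, ?_⟩
    · rw [abs_of_nonneg hm] at hb1
      have h1 : deriv S (u r) * (2 / R) * S (v t) ≤
          (K ε * S (u r) ^ ε) * (4 / R) * S (v t) ^ ε := by
        gcongr
        norm_num
      have h2 : -(4 * K ε) * (S (u r) ^ ε * S (v t) ^ ε) / R =
          -((K ε * S (u r) ^ ε) * (4 / R) * S (v t) ^ ε) := by ring
      rw [h2]
      linarith
    · have : 0 ≤ deriv S (u r) * (2 / R) * S (v t) := by positivity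
      linarith
    · have h0 : deriv (deriv S) (u r) * (-(2 / R)) * (-(2 / R)) * S (v t) =
          deriv (deriv S) (u r) * ((4 / R ^ 2) * S (v t)) := by ring
      rw [h0, abs_mul, abs_of_nonneg (show 0 ≤ (4 / R ^ 2) * S (v t) by positivity)]
      calc |deriv (deriv S) (u r)| * ((4 / R ^ 2) * S (v t))
          ≤ (K ε * S (u r) ^ ε) * ((4 / R ^ 2) * S (v t) ^ ε) := by gcongr
        _ = _ := by ring
end
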